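/- arXiv:1911.00645 — 3 statements merged into one kernel-verified Lean document; each statement's English description precedes it below -/
import Mathlib

section
/- For any d ≥ 1, L ≥ 2, any target Φ ∈ ℝ^{d×d}, and any weight matrices W_1,…,W_L ∈ ℝ^{d×d}, the balancing identity (∇_l R) W_lᵀ = W_{l+1}ᵀ (∇_{l+1} R) holds for every l = 1,…,L−1. -/
open Matrix

namespace ZAS

/-- `seg W l₁ l₂ = W l₂ * W (l₂-1) * ⋯ * W l₁` (the empty product, when `l₂ < l₁`, is `1`). -/
noncomputable def seg {d : ℕ} (W : ℕ → Matrix (Fin d) (Fin d) ℝ) (l₁ : ℕ) :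
    ℕ → Matrix (Fin d) (Fin d) ℝ
  | 0 => 1
  | (k+1) => if k + 1 < l₁ then 1 else W (k+1) * seg W l₁ k

/-- Squared Frobenius norm `‖A‖_F²`. -/
noncomputable def frobSq {m n : ℕ} (A : Matrix (Fin m) (Fin n) ℝ) : ℝ :=
  ∑ i, ∑ j, (A i j)^2

/-- Frobenius norm `‖A‖_F`. -/
noncomputable def frob {m n : ℕ} (A : Matrix (Fin m) (Fin n) ℝ) : ℝ :=
  Real.sqrt (frobSq A)

/-- Frobenius inner product `⟨A, B⟩ = tr(Aᵀ B)`. -/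
noncomputable def finner {m n : ℕ} (A B : Matrix (Fin m) (Fin n) ℝ) : ℝ :=
  ∑ i, ∑ j, A i j * B i j

/-- The loss `R(W_1, …, W_L) = (1/2) ‖W_{L:1} - Φ‖_F²`. -/
noncomputable def loss {d : ℕ} (W : ℕ → Matrix (Fin d) (Fin d) ℝ)
    (Φ : Matrix (Fin d) (Fin d) ℝ) (L : ℕ) : ℝ :=
  frobSq (seg W 1 L - Φ) / 2

/-- The gradient `∇_l R = W_{L:l+1}ᵀ (W_{L:1} - Φ) W_{l-1:1}ᵀ`. -/
noncomputable def grad {d : ℕ} (W : ℕ → Matrix (Fin d) (Fin d) ℝ)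
    (Φ : Matrix (Fin d) (Fin d) ℝ) (L l : ℕ) : Matrix (Fin d) (Fin d) ℝ :=
  (seg W (l+1) L)ᵀ * (seg W 1 L - Φ) * (seg W 1 (l-1))ᵀ

/-- The invariant matrices `D_l = W_{l+1}ᵀ W_{l+1} - W_l W_lᵀ`. -/
noncomputable def Dmat {d : ℕ} (W : ℕ → Matrix (Fin d) (Fin d) ℝ) (l : ℕ) :
    Matrix (Fin d) (Fin d) ℝ :=
  (W (l+1))ᵀ * W (l+1) - W l * (W l)ᵀ

/-- Spectral norm (operator 2-norm) of a square real matrix. -/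
noncomputable def spec {d : ℕ} (A : Matrix (Fin d) (Fin d) ℝ) : ℝ :=
  ‖Matrix.toEuclideanCLM (𝕜 := ℝ) A‖

/-- The loss on data: `R̃ = (1/2) ‖W_{L:1} X - Y‖_F²`. -/
noncomputable def lossT {d n : ℕ} (W : ℕ → Matrix (Fin d) (Fin d) ℝ)
    (X Y : Matrix (Fin d) (Fin n) ℝ) (L : ℕ) : ℝ :=
  frobSq (seg W 1 L * X - Y) / 2

/-- The gradient of the data loss: `∇_l R̃ = W_{L:l+1}ᵀ (W_{L:1} X - Y) Xᵀ W_{l-1:1}ᵀ`. -/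
noncomputable def gradT {d n : ℕ} (W : ℕ → Matrix (Fin d) (Fin d) ℝ)
    (X Y : Matrix (Fin d) (Fin n) ℝ) (L l : ℕ) : Matrix (Fin d) (Fin d) ℝ :=
  (seg W (l+1) L)ᵀ * (seg W 1 L * X - Y) * Xᵀ * (seg W 1 (l-1))ᵀ

end ZAS

open ZAS
/-- Splitting the rightmost factor off a nonempty product. -/
theorem seg_eq_seg_succ_mul {d : ℕ} (W : ℕ → Matrix (Fin d) (Fin d) ℝ) {m n : ℕ}
    (hm : 1 ≤ m) (hmn : m ≤ n) : seg W m n = seg W (m + 1) n * W m := by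
  obtain ⟨k, rfl⟩ : ∃ k, m = k + 1 := ⟨m - 1, by omega⟩
  induction n, hmn using Nat.le_induction with
  | base =>
    have h : seg W (k + 1) k = 1 := by cases k <;> simp [seg]
    simp [seg, h]
  | succ n hn ih =>
    rw [seg, seg, if_neg (by omega), if_neg (by omega), ih, Matrix.mul_assoc]

/-- Splitting the leftmost factor off a nonempty product. -/
theorem seg_one_eq_mul_seg_pred {d : ℕ} (W : ℕ → Matrix (Fin d) (Fin d) ℝ) {n : ℕ}
    (hn : 1 ≤ n) : seg W 1 n = W n * seg W 1 (n - 1) := by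
  obtain ⟨k, rfl⟩ : ∃ k, n = k + 1 := ⟨n - 1, by omega⟩
  simp [seg]

/-- the balancing identity `(∇_l R) W_lᵀ = W_{l+1}ᵀ (∇_{l+1} R)`. -/
theorem grad_balancing_identity
    (d L : ℕ) (hd : 1 ≤ d) (hL : 2 ≤ L)
    (Φ : Matrix (Fin d) (Fin d) ℝ)
    (W : ℕ → Matrix (Fin d) (Fin d) ℝ)
    (l : ℕ) (hl1 : 1 ≤ l) (hl2 : l ≤ L - 1) :
    grad W Φ L l * (W l)ᵀ = (W (l+1))ᵀ * grad W Φ L (l+1) := by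
  rw [grad, grad, Nat.add_sub_cancel, seg_one_eq_mul_seg_pred W hl1,
    seg_eq_seg_succ_mul W (m := l + 1) (n := L) (by omega) (by omega)]
  simp only [Matrix.transpose_mul, Matrix.mul_assoc]
end

section
/- Let d ≥ 1, L ≥ 1, n ≥ 1, X ∈ ℝ^{d×n}, Y ∈ ℝ^{d×n}, and suppose λ_X := λ_min(Xᵀ X) > 0. Suppose W_1,…,W_L : [0,∞) → ℝ^{d×d} are differentiable and satisfy d/dt W_l(t) = −∇_l R̃(t) for l = 1,…,L, with zero-asymmetric initialization W_l(0) = I for l = 1,…,L−1 and W_L(0) = 0. Then R̃(t) ≤ e^{−2 λ_X t} R̃(0) for all t ≥ 0. -/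
open Matrix

namespace ZAS

section Algebra

variable {d m n : ℕ}

theorem seg_of_lt (W : ℕ → Matrix (Fin d) (Fin d) ℝ) {l k : ℕ} (h : k < l) : seg W l k = 1 := by
  cases k with
  | zero => rfl
  | succ k => simp [seg, h]

theorem seg_succ (W : ℕ → Matrix (Fin d) (Fin d) ℝ) {l k : ℕ} (h : l ≤ k + 1) :
    seg W l (k + 1) = W (k + 1) * seg W l k := by
  simp [seg, Nat.not_lt.mpr h]

theorem seg_eq_seg_succ_mul (W : ℕ → Matrix (Fin d) (Fin d) ℝ) {l k : ℕ} (hl : 1 ≤ l)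
    (h : l ≤ k) : seg W l k = seg W (l + 1) k * W l := by
  induction k with
  | zero => omega
  | succ k ih =>
    rcases h.eq_or_lt with rfl | h
    · simp [seg_succ, seg_of_lt]
    · rw [seg_succ W h.le, seg_succ W h, ih (by omega), Matrix.mul_assoc]

theorem finner_eq_trace (A B : Matrix (Fin m) (Fin n) ℝ) : finner A B = (Aᵀ * B).trace := by
  simp only [finner, trace, diag, mul_apply, transpose_apply]
  exact Finset.sum_comm

theorem frobSq_eq_finner (A : Matrix (Fin m) (Fin n) ℝ) : frobSq A = finner A A := by
  simp [frobSq, finner, sq]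

theorem frobSq_nonneg (A : Matrix (Fin m) (Fin n) ℝ) : 0 ≤ frobSq A :=
  Finset.sum_nonneg fun _ _ => Finset.sum_nonneg fun _ _ => sq_nonneg _

theorem frobSq_eq_sum_dotProduct (A : Matrix (Fin m) (Fin n) ℝ) :
    frobSq A = ∑ i, A i ⬝ᵥ A i := by
  simp [frobSq, dotProduct, sq]

theorem mulVec_dotProduct_mulVec (A : Matrix (Fin m) (Fin n) ℝ) (v : Fin n → ℝ) :
    (A *ᵥ v) ⬝ᵥ (A *ᵥ v) = v ⬝ᵥ ((Aᵀ * A) *ᵥ v) := by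
  rw [← mulVec_mulVec, dotProduct_mulVec v, vecMul_transpose]

theorem frobSq_mul_transpose (M : Matrix (Fin m) (Fin n) ℝ) (A : Matrix (Fin d) (Fin n) ℝ) :
    frobSq (M * Aᵀ) = ∑ i, (A *ᵥ M i) ⬝ᵥ (A *ᵥ M i) := by
  rw [frobSq_eq_sum_dotProduct]
  have h (i) : (M * Aᵀ) i = A *ᵥ M i := by
    ext j
    simp [mul_apply, mulVec, dotProduct, mul_comm]
  simp [h]

theorem mul_frobSq_le_frobSq_mul_transpose {c : ℝ} {A : Matrix (Fin d) (Fin n) ℝ}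
    (hA : ∀ v, c * (v ⬝ᵥ v) ≤ (A *ᵥ v) ⬝ᵥ (A *ᵥ v)) (M : Matrix (Fin m) (Fin n) ℝ) :
    c * frobSq M ≤ frobSq (M * Aᵀ) := by
  rw [frobSq_mul_transpose, frobSq_eq_sum_dotProduct, Finset.mul_sum]
  exact Finset.sum_le_sum fun i _ => hA (M i)

/-- `A` does not decrease the Euclidean norm of any vector. -/
def Expansive (A : Matrix (Fin m) (Fin n) ℝ) : Prop :=
  ∀ v, v ⬝ᵥ v ≤ (A *ᵥ v) ⬝ᵥ (A *ᵥ v)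

theorem expansive_one : Expansive (1 : Matrix (Fin d) (Fin d) ℝ) := fun v => by simp

theorem Expansive.mul {A B : Matrix (Fin d) (Fin d) ℝ} (hA : Expansive A) (hB : Expansive B) :
    Expansive (A * B) := fun v => by
  rw [← mulVec_mulVec]
  exact (hB v).trans (hA _)

theorem Expansive.of_transpose {A : Matrix (Fin d) (Fin d) ℝ} (hA : Expansive Aᵀ) :
    Expansive A := by
  have hinj : Function.Injective Aᵀ.mulVecLin := by
    rw [injective_iff_map_eq_zero]
    intro v hv
    have h := hA v
    rw [mulVecLin_apply] at hv
    rw [hv, dotProduct_zero] at h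
    exact dotProduct_self_eq_zero.mp (h.antisymm (Finset.sum_nonneg fun _ _ => mul_self_nonneg _))
  intro v
  obtain ⟨u, hu⟩ := LinearMap.surjective_of_injective hinj v
  rw [mulVecLin_apply] at hu
  have h1 : v ⬝ᵥ v = (A *ᵥ v) ⬝ᵥ u := by
    nth_rewrite 2 [← hu]
    rw [dotProduct_mulVec, vecMul_transpose]
  have h2 : ((A *ᵥ v) ⬝ᵥ u) ^ 2 ≤ ((A *ᵥ v) ⬝ᵥ (A *ᵥ v)) * (u ⬝ᵥ u) := by
    simpa [dotProduct, sq] using Finset.sum_mul_sq_le_sq_mul_sq Finset.univ (A *ᵥ v) u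
  have h3 : u ⬝ᵥ u ≤ v ⬝ᵥ v := hu ▸ hA u
  have h4 : 0 ≤ (A *ᵥ v) ⬝ᵥ (A *ᵥ v) := Finset.sum_nonneg fun _ _ => mul_self_nonneg _
  rw [← h1] at h2
  by_contra! h
  nlinarith [mul_le_mul_of_nonneg_left h3 h4]

theorem Expansive.of_transpose_mul_self_eq {A : Matrix (Fin d) (Fin n) ℝ}
    {B : Matrix (Fin m) (Fin n) ℝ} (hA : Expansive A) (h : Aᵀ * A = Bᵀ * B) : Expansive B :=
  fun v => by
    rw [mulVec_dotProduct_mulVec, ← h, ← mulVec_dotProduct_mulVec]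
    exact hA v

theorem expansive_seg {W : ℕ → Matrix (Fin d) (Fin d) ℝ} {k : ℕ}
    (h : ∀ l, 1 ≤ l → l ≤ k → Expansive (W l)) : Expansive (seg W 1 k) := by
  induction k with
  | zero => exact expansive_one
  | succ k ih =>
    rw [seg_succ W (by omega)]
    exact (h _ (by omega) le_rfl).mul (ih fun l h1 h2 => h l h1 (by omega))

theorem iInf_eigenvalues_mul_dotProduct_le {A : Matrix (Fin n) (Fin n) ℝ} (hA : A.IsHermitian)
    (v : Fin n → ℝ) : (⨅ i, hA.eigenvalues i) * (v ⬝ᵥ v) ≤ v ⬝ᵥ (A *ᵥ v) := by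
  set U : Matrix (Fin n) (Fin n) ℝ := hA.eigenvectorUnitary.1
  have hUU : U * Uᵀ = 1 := by
    have := Unitary.coe_mul_star_self hA.eigenvectorUnitary
    rwa [Unitary.coe_star, star_eq_conjTranspose, conjTranspose_eq_transpose_of_trivial] at this
  have hspec : A = U * diagonal hA.eigenvalues * Uᵀ := by
    have := hA.spectral_theorem
    rwa [Unitary.conjStarAlgAut_apply, star_eq_conjTranspose,
      conjTranspose_eq_transpose_of_trivial] at this
  have h1 : v ⬝ᵥ v = (Uᵀ *ᵥ v) ⬝ᵥ (Uᵀ *ᵥ v) := by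
    rw [mulVec_dotProduct_mulVec, transpose_transpose, hUU, one_mulVec]
  have h2 : v ⬝ᵥ (A *ᵥ v) = (Uᵀ *ᵥ v) ⬝ᵥ (diagonal hA.eigenvalues *ᵥ (Uᵀ *ᵥ v)) := by
    conv_lhs => rw [hspec]
    rw [← mulVec_mulVec, ← mulVec_mulVec, dotProduct_mulVec v, ← mulVec_transpose]
  rw [h1, h2, dotProduct, dotProduct, Finset.mul_sum]
  refine Finset.sum_le_sum fun i _ => ?_
  rw [mulVec_diagonal]
  nlinarith [ciInf_le (Set.finite_range hA.eigenvalues).bddBelow i, mul_self_nonneg ((Uᵀ *ᵥ v) i)]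

end Algebra

section Calculus

variable {k m n : ℕ} {s : Set ℝ} {t : ℝ}

/-- Entrywise derivative of a matrix-valued function within a set. -/
def HasEntryDeriv (A : ℝ → Matrix (Fin m) (Fin n) ℝ) (A' : Matrix (Fin m) (Fin n) ℝ)
    (s : Set ℝ) (t : ℝ) : Prop :=
  ∀ i j, HasDerivWithinAt (fun x => A x i j) (A' i j) s t

theorem HasEntryDeriv.mul {A : ℝ → Matrix (Fin m) (Fin n) ℝ} {B : ℝ → Matrix (Fin n) (Fin k) ℝ}
    {A' : Matrix (Fin m) (Fin n) ℝ} {B' : Matrix (Fin n) (Fin k) ℝ}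
    (hA : HasEntryDeriv A A' s t) (hB : HasEntryDeriv B B' s t) :
    HasEntryDeriv (fun x => A x * B x) (A' * B t + A t * B') s t := fun i j => by
  simp only [mul_apply, Matrix.add_apply, ← Finset.sum_add_distrib]
  exact HasDerivWithinAt.fun_sum fun a _ => (hA i a).mul (hB a j)

theorem HasEntryDeriv.transpose {A : ℝ → Matrix (Fin m) (Fin n) ℝ}
    {A' : Matrix (Fin m) (Fin n) ℝ} (hA : HasEntryDeriv A A' s t) :
    HasEntryDeriv (fun x => (A x)ᵀ) A'ᵀ s t := fun i j => hA j i

theorem HasEntryDeriv.sub {A B : ℝ → Matrix (Fin m) (Fin n) ℝ}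
    {A' B' : Matrix (Fin m) (Fin n) ℝ} (hA : HasEntryDeriv A A' s t)
    (hB : HasEntryDeriv B B' s t) : HasEntryDeriv (fun x => A x - B x) (A' - B') s t :=
  fun i j => (hA i j).sub (hB i j)

theorem hasEntryDeriv_const (A : Matrix (Fin m) (Fin n) ℝ) :
    HasEntryDeriv (fun _ => A) 0 s t := fun i j => hasDerivWithinAt_const t s (A i j)

theorem HasEntryDeriv.frobSq {A : ℝ → Matrix (Fin m) (Fin n) ℝ}
    {A' : Matrix (Fin m) (Fin n) ℝ} (hA : HasEntryDeriv A A' s t) :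
    HasDerivWithinAt (fun x => frobSq (A x)) (2 * finner (A t) A') s t := by
  simp only [ZAS.frobSq, finner, Finset.mul_sum]
  refine HasDerivWithinAt.fun_sum fun i _ => HasDerivWithinAt.fun_sum fun j _ => ?_
  refine ((hA i j).fun_pow 2).congr_deriv ?_
  push_cast
  ring

theorem HasEntryDeriv.seg {d L : ℕ} {W : ℕ → ℝ → Matrix (Fin d) (Fin d) ℝ}
    {W' : ℕ → Matrix (Fin d) (Fin d) ℝ}
    (hW : ∀ l, 1 ≤ l → l ≤ L → HasEntryDeriv (W l) (W' l) s t) :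
    HasEntryDeriv (fun x => seg (fun k => W k x) 1 L)
      (∑ a ∈ Finset.range L, ZAS.seg (fun k => W k t) (a + 2) L * W' (a + 1) *
        ZAS.seg (fun k => W k t) 1 a) s t := by
  induction L with
  | zero => exact hasEntryDeriv_const 1
  | succ L ih =>
    have h := (hW (L + 1) (by omega) le_rfl).mul (ih fun l h1 h2 => hW l h1 (by omega))
    simp only [seg_succ _ (Nat.le_add_left 1 L)]
    convert h using 1
    rw [Finset.sum_range_succ, seg_of_lt _ (by omega), Matrix.one_mul, add_comm, Matrix.mul_sum]
    congr 1
    refine Finset.sum_congr rfl fun a ha => ?_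
    rw [Finset.mem_range] at ha
    rw [seg_succ _ (by omega)]
    simp only [Matrix.mul_assoc]

theorem eq_of_hasEntryDeriv_zero {A : ℝ → Matrix (Fin m) (Fin n) ℝ}
    (hA : ∀ x ∈ Set.Ici (0 : ℝ), HasEntryDeriv A 0 (Set.Ici 0) x) (ht : 0 ≤ t) :
    A t = A 0 := by
  ext i j
  refine constant_of_has_deriv_right_zero (f := fun x => A x i j) (a := 0) (b := t)
    (fun x hx => ?_) (fun x hx => ?_) t ⟨ht, le_rfl⟩
  · exact (hA x hx.1 i j).continuousWithinAt.mono fun y hy => hy.1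
  · exact (hA x hx.1 i j).mono fun y hy => hx.1.trans hy

end Calculus

section GradientFlow

variable {d L n : ℕ} {X Y : Matrix (Fin d) (Fin n) ℝ} {W : ℕ → ℝ → Matrix (Fin d) (Fin d) ℝ}

/-- Gradient flow of the data loss on `[0, ∞)`. -/
def IsGradFlow (W : ℕ → ℝ → Matrix (Fin d) (Fin d) ℝ) (X Y : Matrix (Fin d) (Fin n) ℝ)
    (L : ℕ) : Prop :=
  ∀ t ∈ Set.Ici (0 : ℝ), ∀ l, 1 ≤ l → l ≤ L →
    HasEntryDeriv (W l) (-gradT (fun k => W k t) X Y L l) (Set.Ici 0) t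

theorem transpose_mul_gradT_succ (V : ℕ → Matrix (Fin d) (Fin d) ℝ) {l : ℕ} (hl : 1 ≤ l)
    (hlL : l + 1 ≤ L) :
    (V (l + 1))ᵀ * gradT V X Y L (l + 1) = gradT V X Y L l * (V l)ᵀ := by
  obtain ⟨m, rfl⟩ : ∃ m, l = m + 1 := ⟨l - 1, by omega⟩
  rw [gradT, gradT, seg_eq_seg_succ_mul V (l := m + 1 + 1) (by omega) hlL]
  simp only [Nat.add_sub_cancel, seg_succ V (Nat.le_add_left 1 m), transpose_mul,
    Matrix.mul_assoc]

theorem IsGradFlow.Dmat_eq (h : IsGradFlow W X Y L) {l : ℕ} (hl : 1 ≤ l) (hlL : l + 1 ≤ L)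
    {t : ℝ} (ht : 0 ≤ t) : Dmat (fun k => W k t) l = Dmat (fun k => W k 0) l := by
  refine eq_of_hasEntryDeriv_zero (A := fun x => Dmat (fun k => W k x) l) (fun x hx => ?_) ht
  have h1 := h x hx (l + 1) (by omega) hlL
  have h0 := h x hx l hl (by omega)
  convert (h1.transpose.mul h1).sub (h0.mul h0.transpose) using 1
  · rfl
  have e := transpose_mul_gradT_succ (X := X) (Y := Y) (fun k => W k x) hl hlL
  have e' := congrArg Matrix.transpose e
  simp only [transpose_mul, transpose_transpose] at e'
  simp only [transpose_neg, Matrix.neg_mul, Matrix.mul_neg, e, e']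
  abel

theorem IsGradFlow.hasDerivWithinAt_lossT (h : IsGradFlow W X Y L) {t : ℝ} (ht : 0 ≤ t) :
    HasDerivWithinAt (fun x => lossT (fun k => W k x) X Y L)
      (-∑ a ∈ Finset.range L, frobSq (gradT (fun k => W k t) X Y L (a + 1))) (Set.Ici 0) t := by
  have hE := (((HasEntryDeriv.seg (h t ht)).mul (hasEntryDeriv_const X)).sub
    (hasEntryDeriv_const Y)).frobSq.div_const 2
  refine hE.congr_deriv ?_
  rw [mul_div_cancel_left₀ _ two_ne_zero, finner_eq_trace, Matrix.mul_zero, add_zero, sub_zero,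
    Matrix.sum_mul, Matrix.mul_sum, trace_sum, ← Finset.sum_neg_distrib]
  refine Finset.sum_congr rfl fun a _ => ?_
  rw [frobSq_eq_finner, finner_eq_trace]
  nth_rewrite 2 [gradT]
  simp only [Nat.add_sub_cancel, transpose_mul, transpose_transpose, Matrix.mul_neg,
    Matrix.neg_mul, trace_neg, Matrix.mul_assoc]
  rw [← Matrix.mul_assoc (ZAS.seg _ 1 a) X, trace_mul_comm (ZAS.seg _ 1 a * X)]
  simp only [Matrix.mul_assoc]

theorem IsGradFlow.expansive (h : IsGradFlow W X Y L)
    (hinit1 : ∀ l, 1 ≤ l → l ≤ L - 1 → W l 0 = 1) (hinitL : W L 0 = 0) {t : ℝ} (ht : 0 ≤ t)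
    {l : ℕ} (hl : 1 ≤ l) (hlL : l ≤ L - 1) : Expansive (W l t) := by
  obtain ⟨m, rfl⟩ : ∃ m, L = m + 1 := ⟨L - 1, by omega⟩
  rw [Nat.add_sub_cancel] at hlL hinit1
  induction hlL using Nat.decreasingInduction with
  | self =>
    have hD := h.Dmat_eq hl le_rfl ht
    simp only [Dmat, hinitL, hinit1 m hl le_rfl] at hD
    refine Expansive.of_transpose fun v => ?_
    have e : W m t * (W m t)ᵀ = 1 + (W (m + 1) t)ᵀ * W (m + 1) t := by
      rw [sub_eq_iff_eq_add] at hD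
      simp [hD]
    rw [mulVec_dotProduct_mulVec, transpose_transpose, e, add_mulVec, one_mulVec, dotProduct_add,
      ← mulVec_dotProduct_mulVec, le_add_iff_nonneg_right]
    exact Finset.sum_nonneg fun _ _ => mul_self_nonneg _
  | of_succ l hlm ih =>
    have hD := h.Dmat_eq hl (by omega) ht
    simp only [Dmat, hinit1 l hl hlm.le, hinit1 (l + 1) (by omega) hlm] at hD
    refine Expansive.of_transpose ((ih (by omega)).of_transpose_mul_self_eq ?_)
    rw [transpose_transpose, ← sub_eq_zero, hD]
    simp

theorem IsGradFlow.mul_lossT_le_frobSq_gradT (h : IsGradFlow W X Y L)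
    (hinit1 : ∀ l, 1 ≤ l → l ≤ L - 1 → W l 0 = 1) (hinitL : W L 0 = 0)
    (hH : (Xᵀ * X).IsHermitian) {t : ℝ} (ht : 0 ≤ t) :
    2 * (⨅ i, hH.eigenvalues i) * lossT (fun k => W k t) X Y L ≤
      frobSq (gradT (fun k => W k t) X Y L L) := by
  have hseg : Expansive (ZAS.seg (fun k => W k t) 1 (L - 1)) :=
    expansive_seg fun l h1 h2 => h.expansive hinit1 hinitL ht h1 h2
  rw [gradT, seg_of_lt _ (Nat.lt_succ_self L), transpose_one, Matrix.one_mul, lossT]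
  set E := ZAS.seg (fun k => W k t) 1 L * X - Y
  have h1 := mul_frobSq_le_frobSq_mul_transpose (c := ⨅ i, hH.eigenvalues i) (A := X)
    (fun v => by
      rw [mulVec_dotProduct_mulVec]
      exact iInf_eigenvalues_mul_dotProduct_le hH v) E
  have h2 := mul_frobSq_le_frobSq_mul_transpose (c := 1) (fun v => by
    rw [one_mul]
    exact hseg v) (E * Xᵀ)
  linarith

end GradientFlow

end ZAS

open ZAS
/-- Remark after Theorem 1: for the un-whitened loss
`R̃ = (1/2)‖W_{L:1} X - Y‖_F²` with `λ_X = λ_min(Xᵀ X) > 0`, continuous-time gradient descent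
from the ZAS initialization satisfies `R̃(t) ≤ e^{-2 λ_X t} R̃(0)`. -/
theorem continuous_gd_ZAS_convergence_data
    (d L n : ℕ) (hd : 1 ≤ d) (hL : 1 ≤ L) (hn : 1 ≤ n)
    (X Y : Matrix (Fin d) (Fin n) ℝ)
    (hH : (Xᵀ * X).IsHermitian)
    (hlam : 0 < ⨅ i, hH.eigenvalues i)
    (W : ℕ → ℝ → Matrix (Fin d) (Fin d) ℝ)
    (hdyn : ∀ t ∈ Set.Ici (0:ℝ), ∀ l, 1 ≤ l → l ≤ L → ∀ i j,
      HasDerivWithinAt (fun s => W l s i j)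
        (-((gradT (fun k => W k t) X Y L l) i j)) (Set.Ici 0) t)
    (hinit1 : ∀ l, 1 ≤ l → l ≤ L - 1 → W l 0 = 1)
    (hinitL : W L 0 = 0)
    (t : ℝ) (ht : 0 ≤ t) :
    lossT (fun k => W k t) X Y L
      ≤ Real.exp (-2 * (⨅ i, hH.eigenvalues i) * t) * lossT (fun k => W k 0) X Y L := by
  have hflow : IsGradFlow W X Y L := hdyn
  set c := ⨅ i, hH.eigenvalues i
  set R : ℝ → ℝ := fun x => lossT (fun k => W k x) X Y L
  set R' : ℝ → ℝ := fun x => -∑ a ∈ Finset.range L, frobSq (gradT (fun k => W k x) X Y L (a + 1))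
  have hR' : ∀ x, 0 ≤ x → R' x ≤ -(2 * c * R x) := fun x hx => by
    have h1 := hflow.mul_lossT_le_frobSq_gradT hinit1 hinitL hH hx
    have h2 := Finset.single_le_sum
      (f := fun a => frobSq (gradT (fun k => W k x) X Y L (a + 1)))
      (fun a _ => frobSq_nonneg _) (Finset.mem_range.mpr (Nat.sub_lt hL one_pos))
    simp only [Nat.sub_add_cancel hL] at h2
    exact neg_le_neg (h1.trans h2)
  have hderiv : ∀ x, 0 ≤ x → HasDerivWithinAt (fun x => Real.exp (2 * c * x) * R x)
      (Real.exp (2 * c * x) * (2 * c * R x + R' x)) (Set.Ici 0) x := fun x hx => by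
    have h1 := ((hasDerivWithinAt_id x (Set.Ici (0 : ℝ))).const_mul (2 * c)).exp
    refine (h1.mul (hflow.hasDerivWithinAt_lossT hx)).congr_deriv ?_
    simp only [id_eq, R, R']
    ring
  have hanti : AntitoneOn (fun x => Real.exp (2 * c * x) * R x) (Set.Ici 0) := by
    refine antitoneOn_of_hasDerivWithinAt_nonpos (convex_Ici 0)
      (fun x hx => (hderiv x hx).continuousWithinAt)
      (fun x hx => (hderiv x (interior_subset hx)).mono interior_subset) fun x hx => ?_
    exact mul_nonpos_of_nonneg_of_nonpos (Real.exp_nonneg _)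
      (by linarith [hR' x (interior_subset hx)])
  have h := hanti Set.self_mem_Ici ht ht
  simp only [mul_zero, Real.exp_zero, one_mul] at h
  calc R t = Real.exp (-2 * c * t) * (Real.exp (2 * c * t) * R t) := by
        rw [← mul_assoc, ← Real.exp_add, neg_mul, neg_mul, neg_add_cancel, Real.exp_zero, one_mul]
    _ ≤ Real.exp (-2 * c * t) * R 0 := mul_le_mul_of_nonneg_left h (Real.exp_nonneg _)
end

section
/- Let d ≥ 1, L ≥ 2 and W_1,…,W_{L−1} ∈ ℝ^{d×d}. Suppose ‖W_l‖₂ ≤ α for l = 1,…,L−1 and ‖W_{l+1}ᵀ W_{l+1} − W_l W_lᵀ‖₂ ≤ δ for l = 1,…,L−2. Then for every l = 1,…,L−1, ‖W_{l:1} W_{l:1}ᵀ − (W_l W_lᵀ)^l‖₂ ≤ (l(l−1)/2) α^{2(l−1)} δ; in particular ‖W_{L−1:1} W_{L−1:1}ᵀ − (W_{L−1} W_{L−1}ᵀ)^{L−1}‖₂ ≤ (1/2) L² α^{2(L−2)} δ. -/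
open Matrix

open ZAS
open scoped Matrix.Norms.L2Operator in
theorem spec_eq_l2_opNorm {d : ℕ} (A : Matrix (Fin d) (Fin d) ℝ) : spec A = ‖A‖ := rfl

theorem seg_one_succ {d : ℕ} (W : ℕ → Matrix (Fin d) (Fin d) ℝ) (l : ℕ) :
    seg W 1 (l + 1) = W (l + 1) * seg W 1 l := by
  simp [seg]

theorem norm_pow_succ_sub_pow_succ_le {R : Type*} [NormedRing R] [NormOneClass R] {x y : R}
    {b δ : ℝ} (hx : ‖x‖ ≤ b) (hy : ‖y‖ ≤ b) (hxy : ‖x - y‖ ≤ δ) (n : ℕ) :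
    ‖x ^ (n + 1) - y ^ (n + 1)‖ ≤ (n + 1) * b ^ n * δ := by
  have hb : 0 ≤ b := (norm_nonneg x).trans hx
  induction n with
  | zero => simpa using hxy
  | succ n ih =>
    calc ‖x ^ (n + 1 + 1) - y ^ (n + 1 + 1)‖
        = ‖x ^ (n + 1) * (x - y) + (x ^ (n + 1) - y ^ (n + 1)) * y‖ := by
          congr 1
          rw [pow_succ x (n + 1), pow_succ y (n + 1)]
          noncomm_ring
      _ ≤ ‖x ^ (n + 1)‖ * ‖x - y‖ + ‖x ^ (n + 1) - y ^ (n + 1)‖ * ‖y‖ :=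
          (norm_add_le _ _).trans (add_le_add (norm_mul_le _ _) (norm_mul_le _ _))
      _ ≤ b ^ (n + 1) * δ + ((n + 1) * b ^ n * δ) * b := by
          have h : ‖x ^ (n + 1)‖ ≤ b ^ (n + 1) :=
            (norm_pow_le x _).trans (pow_le_pow_left₀ (norm_nonneg x) hx _)
          have hn := (norm_nonneg _).trans ih
          gcongr
      _ = (↑(n + 1) + 1) * b ^ (n + 1) * δ := by push_cast; ring

theorem mul_transpose_pow_succ {m R : Type*} [Fintype m] [DecidableEq m] [CommRing R]
    (A : Matrix m m R) (n : ℕ) : (A * Aᵀ) ^ (n + 1) = A * (Aᵀ * A) ^ n * Aᵀ := by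
  induction n with
  | zero => simp
  | succ n ih => rw [pow_succ, ih, pow_succ (Aᵀ * A)]; simp only [Matrix.mul_assoc]

open scoped Matrix.Norms.L2Operator in
theorem spec_seg_mul_transpose_sub_pow_le {d : ℕ} (hd : 1 ≤ d)
    (W : ℕ → Matrix (Fin d) (Fin d) ℝ) {α δ : ℝ} (n : ℕ)
    (hW : ∀ l, 1 ≤ l → l ≤ n + 1 → spec (W l) ≤ α)
    (hD : ∀ l, 1 ≤ l → l ≤ n → spec ((W (l + 1))ᵀ * W (l + 1) - W l * (W l)ᵀ) ≤ δ) :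
    spec (seg W 1 (n + 1) * (seg W 1 (n + 1))ᵀ - (W (n + 1) * (W (n + 1))ᵀ) ^ (n + 1))
      ≤ (n + 1) * n / 2 * α ^ (2 * n) * δ := by
  simp only [spec_eq_l2_opNorm] at *
  have : Nonempty (Fin d) := ⟨⟨0, hd⟩⟩
  have : NormOneClass (Matrix (Fin d) (Fin d) ℝ) := ⟨CStarRing.norm_one⟩
  have hT (A : Matrix (Fin d) (Fin d) ℝ) : ‖Aᵀ‖ = ‖A‖ := by
    rw [← conjTranspose_eq_transpose_of_trivial, l2_opNorm_conjTranspose]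
  have hα : 0 ≤ α := (norm_nonneg _).trans (hW 1 le_rfl (by lia))
  induction n with
  | zero => simp [seg]
  | succ n ih =>
    have ih := ih (fun l h₁ h₂ ↦ hW l h₁ (by lia)) (fun l h₁ h₂ ↦ hD l h₁ (by lia))
    have hA := hW (n + 1) (by lia) (by lia)
    have hB := hW (n + 1 + 1) (by lia) le_rfl
    have hAB := hD (n + 1) (by lia) le_rfl
    rw [seg_one_succ W (n + 1), mul_transpose_pow_succ]
    set P := seg W 1 (n + 1)
    set A := W (n + 1)
    set B := W (n + 1 + 1)
    have hAA : ‖A * Aᵀ‖ ≤ α ^ 2 := by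
      rw [sq]
      exact (norm_mul_le _ _).trans (mul_le_mul hA ((hT A).trans_le hA) (norm_nonneg _) hα)
    have hBB : ‖Bᵀ * B‖ ≤ α ^ 2 := by
      rw [sq]
      exact (norm_mul_le _ _).trans (mul_le_mul ((hT B).trans_le hB) hB (norm_nonneg _) hα)
    have hpow := norm_pow_succ_sub_pow_succ_le hBB hAA hAB n
    have hsplit : ‖P * Pᵀ - (Bᵀ * B) ^ (n + 1)‖
        ≤ (n + 1) * n / 2 * α ^ (2 * n) * δ + (n + 1) * (α ^ 2) ^ n * δ := by
      rw [norm_sub_rev] at hpow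
      exact (norm_sub_le_norm_sub_add_norm_sub _ _ _).trans (add_le_add ih hpow)
    calc ‖B * P * (B * P)ᵀ - B * (Bᵀ * B) ^ (n + 1) * Bᵀ‖
        = ‖B * (P * Pᵀ - (Bᵀ * B) ^ (n + 1)) * Bᵀ‖ := by
          simp only [transpose_mul, Matrix.mul_sub, Matrix.sub_mul, Matrix.mul_assoc]
      _ ≤ ‖B‖ * ‖P * Pᵀ - (Bᵀ * B) ^ (n + 1)‖ * ‖B‖ := by
          simpa only [hT] using norm_mul₃_le (a := B) (c := Bᵀ)
      _ ≤ α * ((n + 1) * n / 2 * α ^ (2 * n) * δ + (n + 1) * (α ^ 2) ^ n * δ) * α := by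
          have := (norm_nonneg _).trans hsplit
          gcongr
      _ = (↑(n + 1) + 1) * ↑(n + 1) / 2 * α ^ (2 * (n + 1)) * δ := by
          push_cast; ring

/-- Lemma A.1: if `‖W_l‖₂ ≤ α` for `l ≤ L-1` and
`‖W_{l+1}ᵀ W_{l+1} - W_l W_lᵀ‖₂ ≤ δ` for `l ≤ L-2`, then
`‖W_{l:1} W_{l:1}ᵀ - (W_l W_lᵀ)^l‖₂ ≤ (l(l-1)/2) α^{2(l-1)} δ` for every `l ≤ L-1`; in
particular `‖W_{L-1:1} W_{L-1:1}ᵀ - (W_{L-1} W_{L-1}ᵀ)^{L-1}‖₂ ≤ (1/2) L² α^{2(L-2)} δ`. -/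
theorem approx_balanced_product_bound
    (d L : ℕ) (hd : 1 ≤ d) (hL : 2 ≤ L)
    (W : ℕ → Matrix (Fin d) (Fin d) ℝ) (α δ : ℝ) (hδ : 0 ≤ δ)
    (hW : ∀ l, 1 ≤ l → l ≤ L - 1 → spec (W l) ≤ α)
    (hD : ∀ l, 1 ≤ l → l ≤ L - 2 →
      spec ((W (l+1))ᵀ * W (l+1) - W l * (W l)ᵀ) ≤ δ) :
    (∀ l, 1 ≤ l → l ≤ L - 1 →
      spec (seg W 1 l * (seg W 1 l)ᵀ - (W l * (W l)ᵀ)^l)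
        ≤ (l : ℝ) * ((l : ℝ) - 1) / 2 * α^(2*(l-1)) * δ)
    ∧ spec (seg W 1 (L-1) * (seg W 1 (L-1))ᵀ - (W (L-1) * (W (L-1))ᵀ)^(L-1))
        ≤ 1/2 * (L:ℝ)^2 * α^(2*(L-2)) * δ := by
  have hα : 0 ≤ α := (norm_nonneg _).trans (hW 1 le_rfl (by lia))
  have bound : ∀ l, 1 ≤ l → l ≤ L - 1 →
      spec (seg W 1 l * (seg W 1 l)ᵀ - (W l * (W l)ᵀ)^l)
        ≤ (l : ℝ) * ((l : ℝ) - 1) / 2 * α^(2*(l-1)) * δ := by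
    intro l h₁ h₂
    obtain ⟨n, rfl⟩ := Nat.exists_eq_add_of_le' h₁
    have h := spec_seg_mul_transpose_sub_pow_le hd W n
      (fun k hk hkn ↦ hW k hk (by lia)) (fun k hk hkn ↦ hD k hk (by lia))
    simpa using h
  refine ⟨bound, (bound (L - 1) (by lia) le_rfl).trans ?_⟩
  obtain ⟨n, rfl⟩ := Nat.exists_eq_add_of_le' hL
  rw [show n + 2 - 1 - 1 = n from rfl, show n + 2 - 2 = n from rfl,
    show n + 2 - 1 = n + 1 from rfl]
  gcongr
  push_cast
  nlinarith [n.cast_nonneg (α := ℝ)]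
end
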